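/- Gradient of the Bregman divergence between occupancy measures. Let F : U → ℝ be differentiable on an open set U ⊆ ℝ^{S×A} containing the occupancy measures μ_π of all policies, and let π_t be a fixed policy. For a differentiable parametrized policy θ ↦ π_θ, the map θ ↦ D_F(μ_{π_θ}, μ_{π_t}) is differentiable and ∇_θ D_F(μ_{π_θ}, μ_{π_t}) = ∑_{s,a} d_{π_θ}(s) · Q^{π_θ}(∇F(μ_{π_θ}) − ∇F(μ_{π_t}))(s,a) · ∇_θ π_θ(a|s), where ∇F(μ_{π_θ}) − ∇F(μ_{π_t}) is viewed as a function on S×A. -/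

import Mathlib

open scoped BigOperators

noncomputable section

/-- Policy-induced state transition matrix. -/
def Pmat {S A : Type*} [Fintype A] (P : S → A → S → ℝ) (π : S → A → ℝ) :
    Matrix S S ℝ := fun s' s => ∑ a, P s a s' * π s a

/-- Discounted state distribution. -/
def dpi {S A : Type*} [Fintype S] [DecidableEq S] [Fintype A]
    (P : S → A → S → ℝ) (d0 : S → ℝ) (γ : ℝ) (π : S → A → ℝ) (s : S) : ℝ :=
  (1 - γ) * ∑' t : ℕ, γ ^ t * ((Pmat P π ^ t).mulVec d0 s)

/-- Discounted state-action (occupancy) distribution, as a function on `S × A`. -/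
def mupi {S A : Type*} [Fintype S] [DecidableEq S] [Fintype A]
    (P : S → A → S → ℝ) (d0 : S → ℝ) (γ : ℝ) (π : S → A → ℝ) (p : S × A) : ℝ :=
  dpi P d0 γ π p.1 * π p.1 p.2

/-- The gradient of `F : ℝ^{S×A} → ℝ` at `x`, viewed as a function on `S × A`. -/
def gradF {S A : Type*} [Fintype S] [Fintype A] [DecidableEq S] [DecidableEq A]
    (F : ((S × A) → ℝ) → ℝ) (x : (S × A) → ℝ) (p : S × A) : ℝ :=
  fderiv ℝ F x (Pi.single p 1)

/-- Bregman divergence of `F`: `D_F(x,y) = F(x) - F(y) - ⟨∇F(y), x - y⟩`. -/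
def bregman {S A : Type*} [Fintype S] [Fintype A] [DecidableEq S] [DecidableEq A]
    (F : ((S × A) → ℝ) → ℝ) (x y : (S × A) → ℝ) : ℝ :=
  F x - F y - ∑ p, gradF F y p * (x p - y p)

section helpers

variable {S A : Type*} [Fintype S] [DecidableEq S] [Fintype A]

lemma Pmat_nonneg (P : S → A → S → ℝ) (hPnn : ∀ s a s', 0 ≤ P s a s')
    (π : S → A → ℝ) (hπ : ∀ s a, 0 ≤ π s a) (s' s : S) : 0 ≤ Pmat P π s' s :=
  Finset.sum_nonneg fun a _ => mul_nonneg (hPnn s a s') (hπ s a)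

lemma Pmat_colsum (P : S → A → S → ℝ) (hPsum : ∀ s a, ∑ s', P s a s' = 1)
    (π : S → A → ℝ) (hπ : ∀ s, ∑ a, π s a = 1) (s : S) : ∑ s', Pmat P π s' s = 1 := by
  unfold Pmat
  rw [Finset.sum_comm]
  simp_rw [← Finset.sum_mul, hPsum, one_mul]
  exact hπ s

lemma pow_dist (M : Matrix S S ℝ) (hM : ∀ i j, 0 ≤ M i j) (hc : ∀ j, ∑ i, M i j = 1)
    (d0 : S → ℝ) (hd0nn : ∀ s, 0 ≤ d0 s) (hd0sum : ∑ s, d0 s = 1) (t : ℕ) :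
    (∀ s, 0 ≤ (M ^ t).mulVec d0 s) ∧ ∑ s, (M ^ t).mulVec d0 s = 1 := by
  induction t with
  | zero => simpa using ⟨hd0nn, hd0sum⟩
  | succ t ih =>
    rw [pow_succ', ← Matrix.mulVec_mulVec]
    generalize (M ^ t).mulVec d0 = v at ih
    refine ⟨fun s => Finset.sum_nonneg fun j _ => mul_nonneg (hM s j) (ih.1 j), ?_⟩
    simp only [Matrix.mulVec, dotProduct]
    rw [Finset.sum_comm]
    simp_rw [← Finset.sum_mul, hc, one_mul]
    exact ih.2

lemma summable_dist (M : Matrix S S ℝ) (hM : ∀ i j, 0 ≤ M i j) (hc : ∀ j, ∑ i, M i j = 1)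
    (d0 : S → ℝ) (hd0nn : ∀ s, 0 ≤ d0 s) (hd0sum : ∑ s, d0 s = 1)
    (γ : ℝ) (hγ0 : 0 < γ) (hγ1 : γ < 1) (s : S) :
    Summable fun t : ℕ => γ ^ t * ((M ^ t).mulVec d0 s) := by
  refine Summable.of_nonneg_of_le (fun t => ?_) (fun t => ?_)
    (summable_geometric_of_lt_one hγ0.le hγ1)
  · exact mul_nonneg (by positivity) ((pow_dist M hM hc d0 hd0nn hd0sum t).1 s)
  · obtain ⟨h1, h2⟩ := pow_dist M hM hc d0 hd0nn hd0sum t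
    have : (M ^ t).mulVec d0 s ≤ 1 := by
      rw [← h2]
      exact Finset.single_le_sum (fun i _ => h1 i) (Finset.mem_univ s)
    exact mul_le_of_le_one_right (by positivity) this

lemma dpi_eq (P : S → A → S → ℝ) (hPnn : ∀ s a s', 0 ≤ P s a s')
    (hPsum : ∀ s a, ∑ s', P s a s' = 1)
    (d0 : S → ℝ) (hd0nn : ∀ s, 0 ≤ d0 s) (hd0sum : ∑ s, d0 s = 1)
    (γ : ℝ) (hγ0 : 0 < γ) (hγ1 : γ < 1)
    (π : S → A → ℝ) (hπnn : ∀ s a, 0 ≤ π s a) (hπsum : ∀ s, ∑ a, π s a = 1) (s' : S) :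
    dpi P d0 γ π s' = (1 - γ) * d0 s' + γ * ∑ s, Pmat P π s' s * dpi P d0 γ π s := by
  have hs := summable_dist (Pmat P π) (Pmat_nonneg P hPnn π hπnn) (Pmat_colsum P hPsum π hπsum)
    d0 hd0nn hd0sum γ hγ0 hγ1
  unfold dpi
  rw [(hs s').tsum_eq_zero_add]
  have h1 : ∀ t : ℕ, γ ^ (t + 1) * ((Pmat P π ^ (t + 1)).mulVec d0 s') =
      ∑ s, γ * Pmat P π s' s * (γ ^ t * ((Pmat P π ^ t).mulVec d0 s)) := by
    intro t
    rw [pow_succ' (Pmat P π), ← Matrix.mulVec_mulVec]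
    generalize (Pmat P π ^ t).mulVec d0 = v
    simp only [Matrix.mulVec, dotProduct, Finset.mul_sum]
    refine Finset.sum_congr rfl fun j _ => by ring
  simp_rw [h1]
  rw [Summable.tsum_finsetSum (fun s _ => (hs s).mul_left _)]
  simp_rw [tsum_mul_left]
  simp only [pow_zero, Matrix.one_mulVec, one_mul, mul_add, Finset.mul_sum]
  congr 1
  refine Finset.sum_congr rfl fun j _ => by ring

lemma det_ne (M : Matrix S S ℝ) (hM : ∀ i j, 0 ≤ M i j) (hc : ∀ j, ∑ i, M i j = 1)
    (γ : ℝ) (hγ0 : 0 < γ) (hγ1 : γ < 1) : (1 - γ • M).det ≠ 0 := by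
  intro h
  obtain ⟨v, hv, h0⟩ := Matrix.exists_mulVec_eq_zero_iff.2 h
  apply hv
  have h1 : ∀ i, v i = γ * ∑ j, M i j * v j := by
    intro i
    have := congrFun h0 i
    rw [Matrix.sub_mulVec, Matrix.one_mulVec, Matrix.smul_mulVec] at this
    simp only [Pi.sub_apply, Pi.smul_apply, Pi.zero_apply, smul_eq_mul, Matrix.mulVec,
      dotProduct] at this
    linarith
  have h2 : ∑ i, |v i| ≤ γ * ∑ i, |v i| := by
    calc ∑ i, |v i| ≤ ∑ i, γ * ∑ j, M i j * |v j| := by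
          refine Finset.sum_le_sum fun i _ => ?_
          rw [h1 i, abs_mul, abs_of_pos hγ0]
          refine mul_le_mul_of_nonneg_left ?_ hγ0.le
          refine (Finset.abs_sum_le_sum_abs _ _).trans (Finset.sum_le_sum fun j _ => ?_)
          rw [abs_mul, abs_of_nonneg (hM i j)]
      _ = γ * ∑ i, |v i| := by
          rw [← Finset.mul_sum, Finset.sum_comm]
          simp_rw [← Finset.sum_mul, hc, one_mul]
  have h3 : 0 ≤ ∑ i, |v i| := Finset.sum_nonneg fun i _ => abs_nonneg _
  have h4 : ∑ i, |v i| = 0 := by nlinarith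
  funext i
  have := (Finset.sum_eq_zero_iff_of_nonneg (fun i _ => abs_nonneg (v i))).1 h4 i (Finset.mem_univ i)
  simpa using this

lemma diff_det {E : Type*} [NormedAddCommGroup E] [NormedSpace ℝ E] (M : E → Matrix S S ℝ)
    (hM : ∀ i j, Differentiable ℝ fun x => M x i j) : Differentiable ℝ fun x => (M x).det := by
  simp only [Matrix.det_apply']
  fun_prop

lemma diff_dpi {E : Type*} [NormedAddCommGroup E] [NormedSpace ℝ E]
    (P : S → A → S → ℝ) (hPnn : ∀ s a s', 0 ≤ P s a s')
    (hPsum : ∀ s a, ∑ s', P s a s' = 1)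
    (d0 : S → ℝ) (hd0nn : ∀ s, 0 ≤ d0 s) (hd0sum : ∑ s, d0 s = 1)
    (γ : ℝ) (hγ0 : 0 < γ) (hγ1 : γ < 1)
    (π : E → S → A → ℝ)
    (hπnn : ∀ θ s a, 0 ≤ π θ s a) (hπsum : ∀ θ s, ∑ a, π θ s a = 1)
    (hπdiff : ∀ s a, Differentiable ℝ fun θ => π θ s a) (s : S) :
    Differentiable ℝ fun θ => dpi P d0 γ (π θ) s := by
  have hdet : ∀ θ, (1 - γ • Pmat P (π θ)).det ≠ 0 := fun θ =>
    det_ne _ (Pmat_nonneg P hPnn _ (hπnn θ)) (Pmat_colsum P hPsum _ (hπsum θ)) γ hγ0 hγ1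
  have key : ∀ θ, dpi P d0 γ (π θ) s = ((1 - γ • Pmat P (π θ)).det)⁻¹ *
      ((1 - γ • Pmat P (π θ)).updateCol s ((1 - γ) • d0)).det := by
    intro θ
    have h1 : (1 - γ • Pmat P (π θ)).mulVec (dpi P d0 γ (π θ)) = (1 - γ) • d0 := by
      funext i
      have := dpi_eq P hPnn hPsum d0 hd0nn hd0sum γ hγ0 hγ1 (π θ) (hπnn θ) (hπsum θ) i
      rw [Matrix.sub_mulVec, Matrix.one_mulVec, Matrix.smul_mulVec]
      simp only [Pi.sub_apply, Pi.smul_apply, smul_eq_mul, Matrix.mulVec, dotProduct]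
      linarith
    rw [← Matrix.cramer_apply, ← h1, Matrix.cramer_eq_adjugate_mulVec, Matrix.mulVec_mulVec,
      Matrix.adjugate_mul, Matrix.smul_mulVec, Matrix.one_mulVec, Pi.smul_apply, smul_eq_mul,
      inv_mul_cancel_left₀ (hdet θ)]
  simp_rw [key]
  have hent : ∀ i j, Differentiable ℝ fun θ => (1 - γ • Pmat P (π θ)) i j := by
    intro i j
    simp only [Matrix.sub_apply, Matrix.smul_apply, Pmat, smul_eq_mul]
    fun_prop
  refine Differentiable.mul (Differentiable.inv (diff_det _ hent) hdet) (diff_det _ ?_)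
  intro i j
  simp only [Matrix.updateCol_apply]
  split_ifs
  · fun_prop
  · exact hent i j

/-- The algebraic core: performance-difference style summation by parts. -/
lemma core_alg (P : S → A → S → ℝ) (γ : ℝ) (ρ ρ' r Q : S → A → ℝ) (d d' : S → ℝ)
    (hQ : ∀ s a, Q s a = r s a + γ * ∑ s', P s a s' * ∑ a', ρ s' a' * Q s' a')
    (hd : ∀ s', d' s' = γ * ∑ s, ∑ a, P s a s' * (d s * ρ' s a + d' s * ρ s a)) :
    ∑ s, ∑ a, r s a * (d s * ρ' s a + d' s * ρ s a) = ∑ s, ∑ a, d s * Q s a * ρ' s a := by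
  have h1 : ∑ s', d' s' * ∑ a', ρ s' a' * Q s' a' =
      ∑ s, ∑ a, (γ * ∑ s', P s a s' * ∑ a', ρ s' a' * Q s' a') *
        (d s * ρ' s a + d' s * ρ s a) := by
    have h0 : ∀ (V : S → ℝ) (m : S → A → ℝ), ∑ s', (γ * ∑ s, ∑ a, P s a s' * m s a) * V s' =
        ∑ s, ∑ a, (γ * ∑ s', P s a s' * V s') * m s a := by
      intro V m
      simp only [Finset.mul_sum, Finset.sum_mul]
      rw [Finset.sum_comm]
      refine Finset.sum_congr rfl fun s _ => ?_
      rw [Finset.sum_comm]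
      refine Finset.sum_congr rfl fun a _ => Finset.sum_congr rfl fun s' _ => by ring
    rw [← h0 (fun s' => ∑ a', ρ s' a' * Q s' a') (fun s a => d s * ρ' s a + d' s * ρ s a)]
    exact Finset.sum_congr rfl fun s' _ => by rw [← hd s']
  have h2 : ∀ s a, r s a * (d s * ρ' s a + d' s * ρ s a) =
      (d s * Q s a * ρ' s a + d' s * (ρ s a * Q s a)) -
      (γ * ∑ s', P s a s' * ∑ a', ρ s' a' * Q s' a') * (d s * ρ' s a + d' s * ρ s a) := by
    intro s a
    linear_combination (-(d s * ρ' s a + d' s * ρ s a)) * hQ s a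
  simp_rw [h2, Finset.sum_sub_distrib, Finset.sum_add_distrib]
  rw [← h1]
  simp_rw [Finset.mul_sum]
  ring

end helpers

/-- Gradient of the Bregman divergence between occupancy measures:
`θ ↦ D_F(μ_{π_θ}, μ_{π_t})` is differentiable with gradient
`∑_{s,a} d_{π_θ}(s) Q^{π_θ}(∇F(μ_{π_θ}) − ∇F(μ_{π_t}))(s,a) ∇_θ π_θ(a|s)`,
where `Q^{π_θ}` of the pseudo-reward is given by its Bellman equation. -/
theorem gradient_bregman_occupancy
    {S A : Type*} [Fintype S] [DecidableEq S] [Fintype A] [DecidableEq A] {n : ℕ}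
    (P : S → A → S → ℝ) (hPnn : ∀ s a s', 0 ≤ P s a s')
    (hPsum : ∀ s a, ∑ s', P s a s' = 1)
    (d0 : S → ℝ) (hd0nn : ∀ s, 0 ≤ d0 s) (hd0sum : ∑ s, d0 s = 1)
    (γ : ℝ) (hγ0 : 0 < γ) (hγ1 : γ < 1)
    (F : ((S × A) → ℝ) → ℝ) (U : Set ((S × A) → ℝ)) (hUopen : IsOpen U)
    (hFdiff : ∀ x ∈ U, DifferentiableAt ℝ F x)
    (hUocc : ∀ ρ : S → A → ℝ, (∀ s a, 0 ≤ ρ s a) → (∀ s, ∑ a, ρ s a = 1) →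
      mupi P d0 γ ρ ∈ U)
    (πt : S → A → ℝ) (hπtnn : ∀ s a, 0 ≤ πt s a) (hπtsum : ∀ s, ∑ a, πt s a = 1)
    (π : EuclideanSpace ℝ (Fin n) → S → A → ℝ)
    (hπnn : ∀ θ s a, 0 ≤ π θ s a) (hπsum : ∀ θ s, ∑ a, π θ s a = 1)
    (hπdiff : ∀ s a, Differentiable ℝ fun θ => π θ s a)
    (Q : EuclideanSpace ℝ (Fin n) → S → A → ℝ)
    (hQ : ∀ θ s a, Q θ s a =
      (gradF F (mupi P d0 γ (π θ)) (s, a) - gradF F (mupi P d0 γ πt) (s, a))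
        + γ * ∑ s', P s a s' * ∑ a', π θ s' a' * Q θ s' a')
    (θ : EuclideanSpace ℝ (Fin n)) :
    DifferentiableAt ℝ (fun θ' => bregman F (mupi P d0 γ (π θ')) (mupi P d0 γ πt)) θ ∧
    fderiv ℝ (fun θ' => bregman F (mupi P d0 γ (π θ')) (mupi P d0 γ πt)) θ
      = ∑ s, ∑ a, (dpi P d0 γ (π θ) s * Q θ s a) •
          fderiv ℝ (fun θ' => π θ' s a) θ := by
  have hd : ∀ s, Differentiable ℝ fun θ => dpi P d0 γ (π θ) s :=
    diff_dpi P hPnn hPsum d0 hd0nn hd0sum γ hγ0 hγ1 π hπnn hπsum hπdiff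
  -- derivative of the occupancy measure
  have hmu : ∀ p : S × A, HasFDerivAt (fun θ' => mupi P d0 γ (π θ') p)
      (dpi P d0 γ (π θ) p.1 • fderiv ℝ (fun θ' => π θ' p.1 p.2) θ +
        π θ p.1 p.2 • fderiv ℝ (fun θ' => dpi P d0 γ (π θ') p.1) θ) θ := fun p =>
    (hd p.1 θ).hasFDerivAt.mul (hπdiff p.1 p.2 θ).hasFDerivAt
  have hmu' := hasFDerivAt_pi.2 hmu
  have hF := (hFdiff _ (hUocc (π θ) (hπnn θ) (hπsum θ))).hasFDerivAt
  have hcomp := HasFDerivAt.comp θ hF hmu'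
  have hlin := HasFDerivAt.fun_sum (u := Finset.univ) fun (p : S × A) _ =>
    ((hmu p).sub_const (mupi P d0 γ πt p)).const_mul (gradF F (mupi P d0 γ πt) p)
  have hB : HasFDerivAt (fun θ' => bregman F (mupi P d0 γ (π θ')) (mupi P d0 γ πt)) _ θ :=
    (hcomp.sub_const (F (mupi P d0 γ πt))).sub hlin
  refine ⟨hB.differentiableAt, ?_⟩
  rw [hB.fderiv]
  ext h
  have hFsum : ∀ v : S × A → ℝ, fderiv ℝ F (mupi P d0 γ (π θ)) v =
      ∑ p, gradF F (mupi P d0 γ (π θ)) p * v p := by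
    intro v
    conv_lhs => rw [← Finset.univ_sum_single v]
    rw [map_sum]
    refine Finset.sum_congr rfl fun p _ => ?_
    have : (Pi.single p (v p) : S × A → ℝ) = v p • Pi.single p (1 : ℝ) := by
      rw [← Pi.single_smul]; simp
    rw [this, map_smul, smul_eq_mul, mul_comm]; rfl
  have hdd : ∀ s', fderiv ℝ (fun θ' => dpi P d0 γ (π θ') s') θ h =
      γ * ∑ s, ∑ a, P s a s' * (dpi P d0 γ (π θ) s * fderiv ℝ (fun θ' => π θ' s a) θ h +
        fderiv ℝ (fun θ' => dpi P d0 γ (π θ') s) θ h * π θ s a) := by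
    intro s'
    have e : (fun θ' => dpi P d0 γ (π θ') s') = fun θ' => (1 - γ) * d0 s' +
        γ * ∑ s, ∑ a, P s a s' * mupi P d0 γ (π θ') (s, a) := by
      funext θ'
      rw [dpi_eq P hPnn hPsum d0 hd0nn hd0sum γ hγ0 hγ1 (π θ') (hπnn θ') (hπsum θ') s']
      simp only [Pmat, mupi, Finset.sum_mul]
      congr 2
      exact Finset.sum_congr rfl fun s _ => Finset.sum_congr rfl fun a _ => by ring
    have hs := ((HasFDerivAt.fun_sum (u := Finset.univ) fun (s : S) _ =>
      HasFDerivAt.fun_sum (u := Finset.univ) fun (a : A) _ =>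
        (hmu (s, a)).const_mul (P s a s')).const_mul γ).const_add ((1 - γ) * d0 s')
    conv_lhs => rw [e]
    rw [hs.fderiv]
    simp only [ContinuousLinearMap.smul_apply, ContinuousLinearMap.sum_apply,
      ContinuousLinearMap.add_apply, smul_eq_mul]
    congr 1
    exact Finset.sum_congr rfl fun s _ => Finset.sum_congr rfl fun a _ => by ring
  have hc := core_alg P γ (π θ) (fun s a => fderiv ℝ (fun θ' => π θ' s a) θ h)
    (fun s a => gradF F (mupi P d0 γ (π θ)) (s, a) - gradF F (mupi P d0 γ πt) (s, a))
    (Q θ) (dpi P d0 γ (π θ)) (fun s => fderiv ℝ (fun θ' => dpi P d0 γ (π θ') s) θ h)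
    (hQ θ) hdd
  simp only [ContinuousLinearMap.sub_apply, ContinuousLinearMap.comp_apply, hFsum,
    ContinuousLinearMap.sum_apply, ContinuousLinearMap.smul_apply, smul_eq_mul]
  rw [← hc, ← Finset.sum_sub_distrib, Fintype.sum_prod_type]
  refine Finset.sum_congr rfl fun s _ => Finset.sum_congr rfl fun a _ => ?_
  simp only [ContinuousLinearMap.pi_apply, ContinuousLinearMap.add_apply,
    ContinuousLinearMap.smul_apply, smul_eq_mul]
  ring
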